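/- Let N ≥ 1 and let σ be a 2N×2N Hermitian positive-definite complex matrix satisfying T σ T = conj(σ) (equivalently, σ has the block form [[X, Y],[conj(Y), conj(X)]]). Then there exist an invertible 2N×2N complex matrix S with S K S† = K and positive real numbers λ₁,…,λ_N such that σ = S D S† where D := diag(λ₁,…,λ_N,λ₁,…,λ_N); moreover each λ_k is a positive eigenvalue of the matrix Kσ. -/

import Mathlib

open Matrix Kronecker BigOperators Finset
open scoped ComplexOrder

noncomputable section

abbrev Idx (N : ℕ) := Fin N ⊕ Fin N

/-- The complex-form symplectic form `K = [[I, 0], [0, -I]]`. -/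
def Km (N : ℕ) : Matrix (Idx N) (Idx N) ℂ := Matrix.fromBlocks 1 0 0 (-1)

/-- The block matrix `T = [[0, I], [I, 0]]`. -/
def Tm (N : ℕ) : Matrix (Idx N) (Idx N) ℂ := Matrix.fromBlocks 0 1 1 0

/-- Entrywise complex conjugate of a matrix. -/
def mconj {m n : Type*} (A : Matrix m n ℂ) : Matrix m n ℂ := A.map (starRingEnd ℂ)

theorem exists_equiv_comp_eq_of_map_univ_eq {ι κ γ : Type*} [Fintype ι] [Fintype κ]
    {f : ι → γ} {g : κ → γ}
    (h : Multiset.map f Finset.univ.val = Multiset.map g Finset.univ.val) :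
    ∃ e : ι ≃ κ, ∀ i, g (e i) = f i := by
  classical
  have hcard (c : γ) : Fintype.card {i // f i = c} = Fintype.card {k // g k = c} := by
    have := congrArg (Multiset.count c) h
    rw [Multiset.count_map, Multiset.count_map] at this
    simp only [Fintype.card_subtype, Finset.card_def, Finset.filter_val]
    simpa only [eq_comm] using this
  exact ⟨Equiv.ofFiberEquiv fun c ↦ Fintype.equivOfCardEq (hcard c),
    fun i ↦ Equiv.ofFiberEquiv_map _ i⟩

theorem exists_equiv_sum_of_map_neg_eq {ι : Type*} [Fintype ι] {N : ℕ}
    (hι : Fintype.card ι = N + N) {f : ι → ℝ} (hf : ∀ i, f i ≠ 0)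
    (h : Multiset.map f Finset.univ.val = Multiset.map (-f) Finset.univ.val) :
    ∃ (e : Fin N ⊕ Fin N ≃ ι) (lam : Fin N → ℝ), (∀ k, 0 < lam k) ∧
      f ∘ e = Sum.elim lam (-lam) := by
  classical
  obtain ⟨p, hp⟩ := exists_equiv_comp_eq_of_map_univ_eq h
  have hp' (i : ι) : f (p i) = -f i := by
    have := hp i
    simp only [Pi.neg_apply] at this
    linarith
  let q : {i // 0 < f i} ≃ {i // ¬0 < f i} := p.subtypeEquiv fun i ↦ by
    rw [hp']
    have := hf i
    constructor
    · intro hi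
      linarith
    · intro hi
      exact lt_of_le_of_ne (by linarith) this.symm
  have hcard : Fintype.card {i // 0 < f i} = N := by
    have h₁ := Fintype.card_congr (Equiv.sumCompl fun i ↦ 0 < f i)
    have h₂ := Fintype.card_congr q
    rw [Fintype.card_sum] at h₁
    omega
  let a : Fin N ≃ {i // 0 < f i} := (Fintype.equivFinOfCardEq hcard).symm
  refine ⟨(Equiv.sumCongr a (a.trans q)).trans (Equiv.sumCompl fun i ↦ 0 < f i),
    fun k ↦ f (a k), fun k ↦ (a k).2, ?_⟩
  funext k
  rcases k with k | k
  · simp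
  · simpa [q] using hp' (a k)

theorem Matrix.IsHermitian.exists_diagonal_sum {N : ℕ} {M : Matrix (Idx N) (Idx N) ℂ}
    (hM : M.IsHermitian) (hunit : IsUnit M) (hneg : M.charpoly = (-M).charpoly) :
    ∃ (W : Matrix (Idx N) (Idx N) ℂ) (lam : Fin N → ℝ), W * Wᴴ = 1 ∧ (∀ k, 0 < lam k) ∧
      M = W * diagonal (Sum.elim (fun k ↦ (lam k : ℂ)) (fun k ↦ -(lam k : ℂ))) * Wᴴ := by
  let U : Matrix (Idx N) (Idx N) ℂ := hM.eigenvectorUnitary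
  have hUU : U * Uᴴ = 1 := Unitary.coe_mul_star_self hM.eigenvectorUnitary
  have hUU' : Uᴴ * U = 1 := Unitary.coe_star_mul_self hM.eigenvectorUnitary
  have hspec : M = U * diagonal (fun i ↦ (hM.eigenvalues i : ℂ)) * Uᴴ := hM.spectral_theorem
  have hroots : Multiset.map hM.eigenvalues Finset.univ.val =
      Multiset.map (-hM.eigenvalues) Finset.univ.val := by
    have h₁ : (-M).charpoly = (diagonal fun i ↦ -(hM.eigenvalues i : ℂ)).charpoly := by
      have : -M = U * diagonal (fun i ↦ -(hM.eigenvalues i : ℂ)) * Uᴴ := by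
        conv_lhs => rw [hspec]
        rw [← neg_mul, ← mul_neg, diagonal_neg]
      rw [this, charpoly_mul_comm, ← mul_assoc, hUU', one_mul]
    have h₂ := hM.roots_charpoly_eq_eigenvalues
    rw [hneg, h₁, charpoly_diagonal, Polynomial.roots_prod _ _
      (Finset.prod_ne_zero_iff.2 fun i _ ↦ Polynomial.X_sub_C_ne_zero _)] at h₂
    simp only [Polynomial.roots_X_sub_C, Multiset.bind_singleton] at h₂
    have h₃ := congrArg (Multiset.map Complex.re) h₂
    simp only [Multiset.map_map] at h₃
    exact h₃.symm
  have hne (i : Idx N) : hM.eigenvalues i ≠ 0 := by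
    have hdet := ((isUnit_iff_isUnit_det M).1 hunit).ne_zero
    rw [hM.det_eq_prod_eigenvalues, Finset.prod_ne_zero_iff] at hdet
    simpa using hdet i (Finset.mem_univ i)
  obtain ⟨e, lam, hlam, he⟩ :=
    exists_equiv_sum_of_map_neg_eq (N := N) (by simp [Fintype.card_sum]) hne hroots
  have hdiag : diagonal (Sum.elim (fun k ↦ (lam k : ℂ)) (fun k ↦ -(lam k : ℂ))) =
      (diagonal fun i ↦ (hM.eigenvalues i : ℂ)).submatrix e e := by
    rw [submatrix_diagonal_equiv]
    congr 1
    funext k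
    have := congrFun he k
    simp only [Function.comp_apply] at this ⊢
    rw [this]
    rcases k with k | k <;> simp
  refine ⟨U.submatrix id e, lam, ?_, hlam, ?_⟩
  · rw [conjTranspose_submatrix, submatrix_mul_equiv, hUU, submatrix_id_id]
  · rw [hdiag, conjTranspose_submatrix, submatrix_mul_equiv, submatrix_mul_equiv, ← hspec,
      submatrix_id_id]

theorem Km_mul_self (N : ℕ) : Km N * Km N = 1 := by
  simp [Km, fromBlocks_multiply]

theorem Tm_mul_self (N : ℕ) : Tm N * Tm N = 1 := by
  simp [Tm, fromBlocks_multiply]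

theorem Tm_mul_Km_mul_Tm (N : ℕ) : Tm N * Km N * Tm N = -Km N := by
  simp [Km, Tm, fromBlocks_multiply, fromBlocks_neg]

theorem Km_transpose (N : ℕ) : (Km N)ᵀ = Km N := by
  simp [Km, fromBlocks_transpose]

theorem Km_conjTranspose (N : ℕ) : (Km N)ᴴ = Km N := by
  simp [Km, fromBlocks_conjTranspose]

theorem Km_eq_diagonal (N : ℕ) :
    Km N = diagonal (Sum.elim (fun _ ↦ (1 : ℂ)) (fun _ ↦ (-1 : ℂ))) := by
  rw [Km, ← fromBlocks_diagonal, diagonal_one, ← diagonal_neg, diagonal_one]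

theorem charpoly_Km_mul_eq_charpoly_neg {N : ℕ} {σ : Matrix (Idx N) (Idx N) ℂ}
    (hσ : σ.IsHermitian) (hstruct : Tm N * σ * Tm N = mconj σ) :
    (Km N * σ).charpoly = (-(Km N * σ)).charpoly := by
  have hconj : mconj σ = σᵀ := by
    conv_rhs => rw [← hσ.eq]
    rfl
  have hT : Tm N * (Km N * σ) * Tm N = (-(σ * Km N))ᵀ := by
    calc Tm N * (Km N * σ) * Tm N
        = Tm N * Km N * (Tm N * Tm N) * σ * Tm N := by
          rw [Tm_mul_self]; simp only [mul_assoc, one_mul]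
      _ = (Tm N * Km N * Tm N) * (Tm N * σ * Tm N) := by simp only [mul_assoc]
      _ = (-(σ * Km N))ᵀ := by
          rw [Tm_mul_Km_mul_Tm, hstruct, hconj, transpose_neg, transpose_mul, Km_transpose,
            neg_mul]
  calc (Km N * σ).charpoly
      = (Tm N * (Km N * σ) * Tm N).charpoly := by
        rw [charpoly_mul_comm (Tm N * _), ← mul_assoc, Tm_mul_self, one_mul]
    _ = (-(Km N * σ)).charpoly := by
        rw [hT, charpoly_transpose, ← mul_neg, charpoly_mul_comm, neg_mul]

/-- Williamson's theorem in the complex phase-space form. -/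
theorem stmt6 (N : ℕ) (hN : 1 ≤ N)
    (σ : Matrix (Idx N) (Idx N) ℂ) (hσ : σ.PosDef)
    (hstruct : Tm N * σ * Tm N = mconj σ) :
    ∃ (S : Matrix (Idx N) (Idx N) ℂ) (lam : Fin N → ℝ),
      IsUnit S ∧ S * Km N * Sᴴ = Km N ∧ (∀ k, 0 < lam k) ∧
      σ = S * Matrix.diagonal
              (Sum.elim (fun k => (lam k : ℂ)) (fun k => (lam k : ℂ))) * Sᴴ ∧
      ∀ k, (lam k : ℂ) ∈ spectrum ℂ (Km N * σ) := by
  classical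
  obtain ⟨C, hC, hσC⟩ : ∃ C : Matrix (Idx N) (Idx N) ℂ, IsUnit C ∧ σ = C * Cᴴ := by
    open scoped MatrixOrder in
    obtain ⟨A, hA⟩ := CStarAlgebra.nonneg_iff_eq_star_mul_self.mp hσ.posSemidef.nonneg
    have hA' : σ = Aᴴ * Aᴴᴴ := by rw [conjTranspose_conjTranspose]; exact hA
    refine ⟨Aᴴ, ?_, hA'⟩
    have := (isUnit_iff_isUnit_det _).1 hσ.isUnit
    rw [hA', det_mul] at this
    exact (isUnit_iff_isUnit_det _).2 (isUnit_of_mul_isUnit_left this)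
  have hCH : IsUnit Cᴴ := hC.star
  have hKunit : IsUnit (Km N) := IsUnit.of_mul_eq_one _ (Km_mul_self N)
  have hM : (Cᴴ * Km N * C).IsHermitian := by
    simp [IsHermitian, conjTranspose_mul, Km_conjTranspose, mul_assoc]
  have hchar : (Cᴴ * Km N * C).charpoly = (Km N * σ).charpoly := by
    rw [mul_assoc, charpoly_mul_comm, hσC, mul_assoc]
  have hcharneg : (-(Cᴴ * Km N * C)).charpoly = (-(Km N * σ)).charpoly := by
    rw [mul_assoc, ← neg_mul, neg_mul_comm, charpoly_mul_comm, hσC, neg_mul, mul_assoc]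
  obtain ⟨W, lam, hW, hlam, hMW⟩ := hM.exists_diagonal_sum ((hCH.mul hKunit).mul hC) (by
    rw [hchar, hcharneg, charpoly_Km_mul_eq_charpoly_neg hσ.1 hstruct])
  have hW' : Wᴴ * W = 1 := mul_eq_one_comm.1 hW
  set D := diagonal (Sum.elim (fun k ↦ (lam k : ℂ)) (fun k ↦ (lam k : ℂ))) with hD
  set L := diagonal (Sum.elim (fun k ↦ (lam k : ℂ)) (fun k ↦ -(lam k : ℂ))) with hL
  let R : Matrix (Idx N) (Idx N) ℂ :=
    diagonal (Sum.elim (fun k ↦ (√(lam k) : ℂ)⁻¹) (fun k ↦ (√(lam k) : ℂ)⁻¹))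
  have hsq (k : Fin N) : (lam k : ℂ) * ((√(lam k) : ℂ)⁻¹ * (√(lam k) : ℂ)⁻¹) = 1 := by
    have h := (hlam k).ne'
    rw [← mul_inv, ← Complex.ofReal_mul, Real.mul_self_sqrt (hlam k).le]
    exact mul_inv_cancel₀ (Complex.ofReal_ne_zero.2 h)
  have hRH : Rᴴ = R := by
    rw [diagonal_conjTranspose]
    congr 1
    funext k
    rcases k with k | k <;> simp
  have hRDR : R * D * R = 1 := by
    rw [hD, diagonal_mul_diagonal, diagonal_mul_diagonal, ← diagonal_one]
    congr 1
    funext k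
    rcases k with k | k <;> simp only [Sum.elim_inl, Sum.elim_inr] <;> linear_combination hsq k
  have hLRKR : L * (R * Km N * R) = 1 := by
    rw [hL, Km_eq_diagonal, diagonal_mul_diagonal, diagonal_mul_diagonal, diagonal_mul_diagonal,
      ← diagonal_one]
    congr 1
    funext k
    rcases k with k | k <;> simp only [Sum.elim_inl, Sum.elim_inr] <;> linear_combination hsq k
  have hSH : (C * W * R)ᴴ = R * Wᴴ * Cᴴ := by
    rw [conjTranspose_mul, conjTranspose_mul, hRH, mul_assoc]
  have hK : C * W * R * Km N * (C * W * R)ᴴ = Km N := by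
    have h₁ : Cᴴ * (Km N * (C * W * R * Km N * (C * W * R)ᴴ)) = Cᴴ * 1 := by
      calc Cᴴ * (Km N * (C * W * R * Km N * (C * W * R)ᴴ))
          = (Cᴴ * Km N * C) * W * (R * Km N * R) * Wᴴ * Cᴴ := by
            rw [hSH]; simp only [mul_assoc]
        _ = W * (L * ((Wᴴ * W) * (R * Km N * R))) * Wᴴ * Cᴴ := by
            rw [hMW]; simp only [mul_assoc]
        _ = Cᴴ * 1 := by rw [hW', one_mul, hLRKR, mul_one, hW, one_mul, mul_one]
    have h₂ := hCH.mul_left_cancel h₁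
    have h₃ := congrArg (Km N * ·) h₂
    simpa only [← mul_assoc, Km_mul_self, one_mul, mul_one] using h₃
  refine ⟨C * W * R, lam, ?_, hK, hlam, ?_, fun k ↦ ?_⟩
  · refine IsUnit.of_mul_eq_one (Km N * (C * W * R)ᴴ * Km N) ?_
    rw [← mul_assoc, ← mul_assoc, hK, Km_mul_self]
  · calc σ = C * (W * (R * D * R) * Wᴴ) * Cᴴ := by rw [hRDR, mul_one, hW, mul_one, hσC]
      _ = C * W * R * D * (C * W * R)ᴴ := by rw [hSH]; simp only [mul_assoc]
  · rw [mem_spectrum_iff_isRoot_charpoly, ← hchar, hMW, charpoly_mul_comm, ← mul_assoc, hW',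
      one_mul, hL, charpoly_diagonal, Polynomial.IsRoot, Polynomial.eval_prod]
    exact Finset.prod_eq_zero (Finset.mem_univ (Sum.inl k)) (by simp)
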